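/- Let X be a standard d-variate Gaussian random vector, m(t) = exp(‖t‖²/2), and define Z(t) = exp(t·X) - m(t) - (m(t)/2)((t·X)² - ‖t‖²) - m(t)(t·X). Then for all s, t ∈ R^d, E[Z(s)Z(t)] = exp((‖s‖² + ‖t‖²)/2)·( e^{s·t} - 1 - s·t - (s·t)²/2 ). -/

import Mathlib

open MeasureTheory ProbabilityTheory
open scoped BigOperators

lemma czk_step {Ω : Type*} [MeasurableSpace Ω] {μ : Measure Ω} {X : Ω → ℝ}
    (hint : ∀ t : ℝ, Integrable (fun w => Real.exp (t * X w)) μ) (n : ℕ) (F : ℝ → ℝ)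
    (hF : ∀ t : ℝ, ∫ w, X w ^ n * Real.exp (t * X w) ∂μ = F t) (t F' : ℝ)
    (h' : HasDerivAt F F' t) :
    ∫ w, X w ^ (n + 1) * Real.exp (t * X w) ∂μ = F' := by
  have hu : integrableExpSet X μ = Set.univ := by
    ext t; simpa [integrableExpSet] using hint t
  have h1 := hasDerivAt_integral_pow_mul_exp_real (X := X) (μ := μ) (t := t) (by simp [hu]) n
  have : (fun t => ∫ w, X w ^ n * Real.exp (t * X w) ∂μ) = F := funext hF
  rw [this] at h1
  exact h1.unique h'

lemma czk_moments {Ω : Type*} [MeasurableSpace Ω] {μ : Measure Ω} {X : Ω → ℝ}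
    (hint : ∀ t : ℝ, Integrable (fun w => Real.exp (t * X w)) μ) (a b : ℝ)
    (h0 : ∀ t : ℝ, ∫ w, Real.exp (t * X w) ∂μ = Real.exp (a * t + b * t ^ 2 / 2)) :
    (∀ n : ℕ, Integrable (fun w => X w ^ n) μ) ∧ ∫ w, X w ∂μ = a ∧
    ∫ w, X w ^ 2 ∂μ = a ^ 2 + b ∧ ∫ w, X w ^ 3 ∂μ = a ^ 3 + 3 * a * b ∧
    ∫ w, X w ^ 4 ∂μ = a ^ 4 + 6 * a ^ 2 * b + 3 * b ^ 2 := by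
  have he : ∀ t : ℝ, HasDerivAt (fun t : ℝ => Real.exp (a * t + b * t ^ 2 / 2))
      (Real.exp (a * t + b * t ^ 2 / 2) * (a + b * t)) t := by
    intro t
    have : HasDerivAt (fun t : ℝ => a * t + b * t ^ 2 / 2) (a + b * t) t := by
      have := ((hasDerivAt_id t).const_mul a).add
        ((((hasDerivAt_id t).pow 2).const_mul b).div_const 2)
      convert! this using 1
      simp; ring
    exact this.exp
  have hl : ∀ t : ℝ, HasDerivAt (fun t : ℝ => a + b * t) b t := by
    intro t
    simpa using ((hasDerivAt_id t).const_mul b).const_add a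
  have m1 : ∀ t : ℝ, ∫ w, X w ^ 1 * Real.exp (t * X w) ∂μ
      = Real.exp (a * t + b * t ^ 2 / 2) * (a + b * t) := fun t =>
    czk_step hint 0 _ (by simpa using h0) t _ (he t)
  have m2 : ∀ t : ℝ, ∫ w, X w ^ 2 * Real.exp (t * X w) ∂μ
      = Real.exp (a * t + b * t ^ 2 / 2) * ((a + b * t) ^ 2 + b) := fun t =>
    czk_step hint 1 _ m1 t _ (by
      convert! (he t).mul (hl t) using 1; ring)
  have m3 : ∀ t : ℝ, ∫ w, X w ^ 3 * Real.exp (t * X w) ∂μ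
      = Real.exp (a * t + b * t ^ 2 / 2) * ((a + b * t) ^ 3 + 3 * (a + b * t) * b) := fun t =>
    czk_step hint 2 _ m2 t _ (by
      convert! (he t).mul (((hl t).pow 2).add_const b) using 1
      simp; ring)
  have m4 : ∀ t : ℝ, ∫ w, X w ^ 4 * Real.exp (t * X w) ∂μ
      = Real.exp (a * t + b * t ^ 2 / 2) *
        ((a + b * t) ^ 4 + 6 * (a + b * t) ^ 2 * b + 3 * b ^ 2) := fun t =>
    czk_step hint 3 _ m3 t _ (by
      convert! (he t).mul (((hl t).pow 3).add (((hl t).const_mul 3).mul_const b)) using 1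
      simp; ring)
  refine ⟨fun n => integrable_pow_of_integrable_exp_mul one_ne_zero (hint _) (hint _) n, ?_⟩
  have m1 := m1 0
  have m2 := m2 0
  have m3 := m3 0
  have m4 := m4 0
  simp at m1 m2 m3 m4
  exact ⟨m1, m2, m3, m4⟩

lemma czk_mgf (d : ℕ) (u : Fin d → ℝ) :
    Integrable (fun x : Fin d → ℝ => Real.exp (∑ i, u i * x i))
      (Measure.pi fun _ : Fin d => gaussianReal 0 1) ∧
    ∫ x : Fin d → ℝ, Real.exp (∑ i, u i * x i) ∂(Measure.pi fun _ : Fin d => gaussianReal 0 1)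
      = Real.exp ((∑ i, u i ^ 2) / 2) := by
  simp_rw [Real.exp_sum]
  constructor
  · exact Integrable.fintype_prod (f := fun i x => Real.exp (u i * x))
      (fun i => integrable_exp_mul_gaussianReal _)
  · rw [integral_fintype_prod_eq_prod (fun i x => Real.exp (u i * x)), Finset.sum_div,
      Real.exp_sum]
    refine Finset.prod_congr rfl fun i _ => ?_
    have := congrFun (mgf_id_gaussianReal (μ := 0) (v := 1)) (u i)
    simpa [mgf] using this

lemma czk_mgf2 (d : ℕ) (s t : Fin d → ℝ) (b : ℝ) :
    Integrable (fun x : Fin d → ℝ => Real.exp (∑ i, s i * x i) * Real.exp (b * ∑ i, t i * x i))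
      (Measure.pi fun _ : Fin d => gaussianReal 0 1) ∧
    ∫ x : Fin d → ℝ, Real.exp (∑ i, s i * x i) * Real.exp (b * ∑ i, t i * x i)
        ∂(Measure.pi fun _ : Fin d => gaussianReal 0 1)
      = Real.exp ((∑ i, s i ^ 2) / 2) *
        Real.exp ((∑ i, s i * t i) * b + (∑ i, t i ^ 2) * b ^ 2 / 2) := by
  have h := czk_mgf d (fun i => s i + b * t i)
  have e1 : ∀ x : Fin d → ℝ, ∑ i, (s i + b * t i) * x i
      = ∑ i, s i * x i + b * ∑ i, t i * x i := by
    intro x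
    rw [Finset.mul_sum, ← Finset.sum_add_distrib]
    exact Finset.sum_congr rfl fun i _ => by ring
  have e2 : (∑ i, (s i + b * t i) ^ 2) / 2 = (∑ i, s i ^ 2) / 2 +
      ((∑ i, s i * t i) * b + (∑ i, t i ^ 2) * b ^ 2 / 2) := by
    simp only [Finset.sum_div, Finset.sum_mul, ← Finset.sum_add_distrib]
    exact Finset.sum_congr rfl fun i _ => by ring
  simpa only [e1, e2, Real.exp_add] using h

/-- Moments of `t·X` weighted by `exp (s·X)`. -/
lemma czk_tilt (d : ℕ) (s t : Fin d → ℝ) :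
    (∀ n : ℕ, Integrable (fun x : Fin d → ℝ => Real.exp (∑ i, s i * x i) * (∑ i, t i * x i) ^ n)
      (Measure.pi fun _ : Fin d => gaussianReal 0 1)) ∧
    ∫ x : Fin d → ℝ, Real.exp (∑ i, s i * x i) * (∑ i, t i * x i)
        ∂(Measure.pi fun _ : Fin d => gaussianReal 0 1)
      = Real.exp ((∑ i, s i ^ 2) / 2) * ∑ i, s i * t i ∧
    ∫ x : Fin d → ℝ, Real.exp (∑ i, s i * x i) * (∑ i, t i * x i) ^ 2
        ∂(Measure.pi fun _ : Fin d => gaussianReal 0 1)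
      = Real.exp ((∑ i, s i ^ 2) / 2) * ((∑ i, s i * t i) ^ 2 + ∑ i, t i ^ 2) := by
  set μ := Measure.pi fun _ : Fin d => gaussianReal 0 1
  have hm := czk_mgf d s
  have hp := Real.exp_pos ((∑ i, s i ^ 2) / 2)
  have key : ∀ g : (Fin d → ℝ) → ℝ, ∫ x, Real.exp (∑ i, s i * x i) * g x ∂μ
      = Real.exp ((∑ i, s i ^ 2) / 2) * ∫ x, g x ∂(μ.tilted fun x => ∑ i, s i * x i) := by
    intro g
    rw [integral_tilted, hm.2, ← integral_const_mul]
    congr 1; ext x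
    simp only [smul_eq_mul]
    field_simp
  obtain ⟨h0, h1, h2, -⟩ := czk_moments (μ := μ.tilted fun x => ∑ i, s i * x i)
    (X := fun x => ∑ i, t i * x i)
    (fun b => by
      rw [integrable_tilted_iff hm.1]
      exact (czk_mgf2 d s t b).1) (∑ i, s i * t i) (∑ i, t i ^ 2)
    (fun b => by
      have := (czk_mgf2 d s t b).2
      rw [key] at this
      exact mul_left_cancel₀ hp.ne' this)
  refine ⟨fun n => ?_, ?_, ?_⟩
  · exact (integrable_tilted_iff hm.1 _).1 (h0 n)
  · rw [key, h1]
  · rw [key, h2]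

/-- Moments of `t·X`. -/
lemma czk_plain (d : ℕ) (t : Fin d → ℝ) :
    (∀ n : ℕ, Integrable (fun x : Fin d → ℝ => (∑ i, t i * x i) ^ n)
      (Measure.pi fun _ : Fin d => gaussianReal 0 1)) ∧
    ∫ x : Fin d → ℝ, (∑ i, t i * x i) ∂(Measure.pi fun _ : Fin d => gaussianReal 0 1) = 0 ∧
    ∫ x : Fin d → ℝ, (∑ i, t i * x i) ^ 2 ∂(Measure.pi fun _ : Fin d => gaussianReal 0 1)
      = ∑ i, t i ^ 2 ∧
    ∫ x : Fin d → ℝ, (∑ i, t i * x i) ^ 3 ∂(Measure.pi fun _ : Fin d => gaussianReal 0 1) = 0 ∧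
    ∫ x : Fin d → ℝ, (∑ i, t i * x i) ^ 4 ∂(Measure.pi fun _ : Fin d => gaussianReal 0 1)
      = 3 * (∑ i, t i ^ 2) ^ 2 := by
  have := czk_moments (μ := Measure.pi fun _ : Fin d => gaussianReal 0 1)
    (X := fun x => ∑ i, t i * x i)
    (fun b => by simpa using (czk_mgf2 d 0 t b).1) 0 (∑ i, t i ^ 2)
    (fun b => by simpa using (czk_mgf2 d 0 t b).2)
  simpa using this

/-- Integrable with prescribed integral. -/
def CzkE {Ω : Type*} [MeasurableSpace Ω] (μ : Measure Ω) (f : Ω → ℝ) (c : ℝ) : Prop :=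
  Integrable f μ ∧ ∫ x, f x ∂μ = c

lemma CzkE.add {Ω : Type*} [MeasurableSpace Ω] {μ : Measure Ω} {f g : Ω → ℝ} {a b : ℝ}
    (hf : CzkE μ f a) (hg : CzkE μ g b) : CzkE μ (fun x => f x + g x) (a + b) :=
  ⟨hf.1.add hg.1, by rw [integral_add hf.1 hg.1, hf.2, hg.2]⟩

lemma CzkE.smul {Ω : Type*} [MeasurableSpace Ω] {μ : Measure Ω} {f : Ω → ℝ} {a : ℝ}
    (k : ℝ) (hf : CzkE μ f a) : CzkE μ (fun x => k * f x) (k * a) :=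
  ⟨hf.1.const_mul k, by rw [integral_const_mul, hf.2]⟩

lemma CzkE.congr {Ω : Type*} [MeasurableSpace Ω] {μ : Measure Ω} {f g : Ω → ℝ} {a b : ℝ}
    (hf : CzkE μ f a) (h : ∀ x, g x = f x) (hab : b = a) : CzkE μ g b := by
  have : g = f := funext h
  rw [this, hab]; exact hf

theorem covariance_kernel_of_Z (d : ℕ) (s t : Fin d → ℝ)
    (Z : (Fin d → ℝ) → (Fin d → ℝ) → ℝ)
    (hZ : ∀ u x, Z u x =
        Real.exp (∑ i, u i * x i) - Real.exp ((∑ i, u i ^ 2) / 2)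
          - Real.exp ((∑ i, u i ^ 2) / 2) / 2 * ((∑ i, u i * x i) ^ 2 - ∑ i, u i ^ 2)
          - Real.exp ((∑ i, u i ^ 2) / 2) * (∑ i, u i * x i)) :
    ∫ x : Fin d → ℝ, Z s x * Z t x ∂(Measure.pi fun _ : Fin d => gaussianReal 0 1)
      = Real.exp (((∑ i, s i ^ 2) + ∑ i, t i ^ 2) / 2) *
          (Real.exp (∑ i, s i * t i) - 1 - (∑ i, s i * t i) - (∑ i, s i * t i) ^ 2 / 2) := by
  have hP (u : Fin d → ℝ) := czk_plain d u
  have hT (u v : Fin d → ℝ) := czk_tilt d u v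
  have hst := czk_mgf2 d s t 1
  have hms := czk_mgf d s
  have hmt := czk_mgf d t
  simp only [hZ]
  set μ := Measure.pi fun _ : Fin d => gaussianReal 0 1
  have P1 (u : Fin d → ℝ) : CzkE μ (fun x => ∑ i, u i * x i) 0 :=
    ⟨by simpa using (hP u).1 1, (hP u).2.1⟩
  have P2 (u : Fin d → ℝ) : CzkE μ (fun x => (∑ i, u i * x i) ^ 2) (∑ i, u i ^ 2) :=
    ⟨(hP u).1 2, (hP u).2.2.1⟩
  have P3 (u : Fin d → ℝ) : CzkE μ (fun x => (∑ i, u i * x i) ^ 3) 0 :=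
    ⟨(hP u).1 3, (hP u).2.2.2.1⟩
  have P4 (u : Fin d → ℝ) : CzkE μ (fun x => (∑ i, u i * x i) ^ 4) (3 * (∑ i, u i ^ 2) ^ 2) :=
    ⟨(hP u).1 4, (hP u).2.2.2.2⟩
  have T0 (u : Fin d → ℝ) : CzkE μ (fun x => Real.exp (∑ i, u i * x i))
      (Real.exp ((∑ i, u i ^ 2) / 2)) := czk_mgf d u
  have T1 (u v : Fin d → ℝ) : CzkE μ (fun x => Real.exp (∑ i, u i * x i) * (∑ i, v i * x i))
      (Real.exp ((∑ i, u i ^ 2) / 2) * ∑ i, u i * v i) :=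
    ⟨by simpa using (hT u v).1 1, (hT u v).2.1⟩
  have T2 (u v : Fin d → ℝ) : CzkE μ (fun x => Real.exp (∑ i, u i * x i) * (∑ i, v i * x i) ^ 2)
      (Real.exp ((∑ i, u i ^ 2) / 2) * ((∑ i, u i * v i) ^ 2 + ∑ i, v i ^ 2)) :=
    ⟨(hT u v).1 2, (hT u v).2.2⟩
  have P0 : CzkE μ (fun _ => (1 : ℝ)) 1 := ⟨integrable_const _, by simp [μ]⟩
  have TT : CzkE μ (fun x => Real.exp (∑ i, s i * x i) * Real.exp (∑ i, t i * x i))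
      (Real.exp ((∑ i, s i ^ 2) / 2) * (Real.exp (∑ i, s i * t i) *
        Real.exp ((∑ i, t i ^ 2) / 2))) := by
    have : CzkE μ _ _ := hst
    simpa [Real.exp_add] using this
  have a1 (x : Fin d → ℝ) : ∑ i, (s + t) i * x i = ∑ i, s i * x i + ∑ i, t i * x i := by
    simp [add_mul, Finset.sum_add_distrib]
  have a2 (x : Fin d → ℝ) : ∑ i, (s - t) i * x i = ∑ i, s i * x i - ∑ i, t i * x i := by
    simp [sub_mul, Finset.sum_sub_distrib]
  have b1 : ∑ i, (s + t) i ^ 2 = ∑ i, s i ^ 2 + 2 * ∑ i, s i * t i + ∑ i, t i ^ 2 := by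
    simp only [Finset.mul_sum, ← Finset.sum_add_distrib]
    exact Finset.sum_congr rfl fun i _ => by simp; ring
  have b2 : ∑ i, (s - t) i ^ 2 = ∑ i, s i ^ 2 - 2 * ∑ i, s i * t i + ∑ i, t i ^ 2 := by
    simp only [Finset.mul_sum, ← Finset.sum_add_distrib, ← Finset.sum_sub_distrib]
    exact Finset.sum_congr rfl fun i _ => by simp; ring
  have U2 := P2 (s + t)
  have U3 := P3 (s + t)
  have U4 := P4 (s + t)
  have V2 := P2 (s - t)
  have V3 := P3 (s - t)
  have V4 := P4 (s - t)
  simp only [a1, b1] at U2 U3 U4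
  simp only [a2, b2] at V2 V3 V4
  have T1' := T1 t s
  have T2' := T2 t s
  have hc : ∑ i, t i * s i = ∑ i, s i * t i := Finset.sum_congr rfl fun i _ => mul_comm _ _
  rw [hc] at T1' T2'
  have S1 := P1 s
  have S2 := P2 s
  have S3 := P3 s
  have S4 := P4 s
  have R1 := P1 t
  have R2 := P2 t
  have R3 := P3 t
  have R4 := P4 t
  have Ts0 := T0 s
  have Tt0 := T0 t
  have Ts1 := T1 s t
  have Ts2 := T2 s t
  rw [add_div, Real.exp_add]
  clear hP hT hst hms hmt P1 P2 P3 P4 T0 T1 T2 a1 a2 b1 b2 hZ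
  generalize Real.exp ((∑ i, s i ^ 2) / 2) = p at *
  generalize Real.exp ((∑ i, t i ^ 2) / 2) = q at *
  generalize Real.exp (∑ i, s i * t i) = eC at *
  generalize (∑ i, s i * t i) = C at *
  generalize (∑ i, s i ^ 2) = A at *
  generalize (∑ i, t i ^ 2) = B at *
  have W := (((TT.add (((Ts0.smul (1 - B / 2)).add (Ts1.add (Ts2.smul (1 / 2)))).smul (-q))).add
    (((Tt0.smul (1 - A / 2)).add (T1'.add (T2'.smul (1 / 2)))).smul (-p))).add
    (((((P0.smul ((1 - A / 2) * (1 - B / 2))).add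
      ((R1.add (R2.smul (1 / 2))).smul (1 - A / 2))).add
      ((S1.add (S2.smul (1 / 2))).smul (1 - B / 2))).add
      ((((U4.add V4).add ((S4.add R4).smul (-2))).smul (1 / 48)).add
        ((((U3.add (V3.smul (-1))).add (R3.smul (-2))).smul (1 / 12)).add
        ((((U3.add V3).add (S3.smul (-2))).smul (1 / 12)).add
          ((U2.add (V2.smul (-1))).smul (1 / 4)))))).smul (p * q)))
  exact (W.congr (fun x => by ring) (by ring)).2
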